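/- arXiv:1909.13372 — 2 statements merged into one kernel-verified Lean document; each statement's English description precedes it below -/
import Mathlib

section
/- If T* is a model companion of a first-order theory T, then T* is axiomatized by its ∀∃ consequences: every L-structure that satisfies each ∀∃ sentence which is a logical consequence of T* is a model of T*. -/
open FirstOrder FirstOrder.Language

universe u v

variable {L : FirstOrder.Language.{u, v}}

/-- A formula is *universal* if it has the form `∀ ȳ, χ` with `χ` quantifier-free. -/
def IsUniversalFormula {α : Type*} (φ : L.Formula α) : Prop :=
  ∃ (n : ℕ) (χ : L.BoundedFormula α n), χ.IsQF ∧ φ = χ.alls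

/-- A formula is *existential* if it has the form `∃ ȳ, χ` with `χ` quantifier-free. -/
def IsExistentialFormula {α : Type*} (φ : L.Formula α) : Prop :=
  ∃ (n : ℕ) (χ : L.BoundedFormula α n), χ.IsQF ∧ φ = χ.exs

/-- A theory is *model complete* if every embedding between models of it is elementary. -/
def IsModelComplete (T : L.Theory) : Prop :=
  ∀ (M N : Type (max u v)) [L.Structure M] [L.Structure N] [Nonempty M] [Nonempty N],
    M ⊨ T → N ⊨ T → ∀ (f : M ↪[L] N) (n : ℕ) (φ : L.Formula (Fin n)) (x : Fin n → M),
      φ.Realize (f ∘ x) ↔ φ.Realize x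

/-- `M` is *existentially closed in `N` via* the embedding `f` if every existential formula
with parameters from `M` that holds in `N` (of the images) already holds in `M`. -/
def IsECVia {M N : Type (max u v)} [L.Structure M] [L.Structure N] (f : M ↪[L] N) : Prop :=
  ∀ (k : ℕ) (φ : L.Formula (Fin k)), IsExistentialFormula φ →
    ∀ x : Fin k → M, φ.Realize (f ∘ x) → φ.Realize x

/-- `M` is *existentially closed for* the theory `T` if `M ⊨ T` and `M` is existentially
closed in every model of `T` via every embedding. -/
def IsECFor (T : L.Theory) (M : Type (max u v)) [L.Structure M] [Nonempty M] : Prop :=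
  M ⊨ T ∧ ∀ (N : Type (max u v)) [L.Structure N] [Nonempty N], N ⊨ T →
    ∀ f : M ↪[L] N, IsECVia f

/-- `T_∀` : the set of universal sentences that are logical consequences of `T`. -/
def universalPart (T : L.Theory) : L.Theory :=
  {φ : L.Sentence | IsUniversalFormula φ ∧ T ⊨ᵇ φ}

/-- `Tstar` is a *model companion* of `T`: `Tstar` is model complete, every model of `T`
embeds into a model of `Tstar`, and every model of `Tstar` embeds into a model of `T`. -/
def IsModelCompanion (T Tstar : L.Theory) : Prop :=
  IsModelComplete Tstar ∧
  (∀ (M : Type (max u v)) [L.Structure M] [Nonempty M], M ⊨ T →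
     ∃ (N : Type (max u v)) (_ : L.Structure N) (_ : Nonempty N),
       N ⊨ Tstar ∧ Nonempty (M ↪[L] N)) ∧
  (∀ (M : Type (max u v)) [L.Structure M] [Nonempty M], M ⊨ Tstar →
     ∃ (N : Type (max u v)) (_ : L.Structure N) (_ : Nonempty N),
       N ⊨ T ∧ Nonempty (M ↪[L] N))

/-- Existentially quantify the last `k` of `n + k` variables. -/
def BoundedFormula.exsAux {α : Type*} :
    ∀ {n k : ℕ}, L.BoundedFormula α (n + k) → L.BoundedFormula α n
  | _, 0, φ => φ
  | _, _ + 1, φ => BoundedFormula.exsAux φ.ex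

/-- A sentence is *∀∃* if it has the form `∀ x̄ ∃ ȳ, χ` with `χ` quantifier-free. -/
def IsAESentence (φ : L.Sentence) : Prop :=
  ∃ (n k : ℕ) (χ : L.BoundedFormula Empty (n + k)),
    χ.IsQF ∧ φ = (BoundedFormula.exsAux χ).alls

section Helpers

lemma isQF_toFormula {α : Type*} {n : ℕ} {φ : L.BoundedFormula α n} (h : φ.IsQF) :
    φ.toFormula.IsQF := by
  induction h with
  | falsum => exact .falsum
  | of_isAtomic h =>
    cases h with
    | equal t₁ t₂ => exact .of_isAtomic (.equal _ _)
    | rel R ts => exact .of_isAtomic (.rel _ _)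
  | imp _ _ h1 h2 => exact h1.imp h2

lemma realize_exsAux {α : Type*} {K : Type*} [L.Structure K] {n k : ℕ}
    (φ : L.BoundedFormula α (n + k)) (v : α → K) (xs : Fin n → K) :
    (BoundedFormula.exsAux φ).Realize v xs ↔ ∃ ys : Fin k → K, φ.Realize v (Fin.append xs ys) := by
  induction k with
  | zero =>
    have : ∀ ys : Fin 0 → K, Fin.append xs ys = xs := fun ys => by
      rw [Subsingleton.elim ys Fin.elim0]; simp
    simp only [BoundedFormula.exsAux, this]
    exact ⟨fun h => ⟨Fin.elim0, h⟩, fun ⟨_, h⟩ => h⟩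
  | succ k ih =>
    rw [BoundedFormula.exsAux, ih]
    constructor
    · rintro ⟨ys, h⟩
      obtain ⟨a, ha⟩ := BoundedFormula.realize_ex.1 h
      exact ⟨Fin.snoc ys a, by rwa [Fin.append_snoc]⟩
    · rintro ⟨ys, h⟩
      refine ⟨Fin.init ys, BoundedFormula.realize_ex.2 ⟨ys (Fin.last k), ?_⟩⟩
      rw [← Fin.append_snoc, Fin.snoc_init_self]
      exact h

lemma exists_fin_retract {A : Type*} [Nonempty A] (V : Finset A) :
    ∃ (k : ℕ) (a : Fin k → A) (g : A → Fin k), ∀ i ∈ V, a (g i) = i := by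
  classical
  obtain ⟨a0⟩ := ‹Nonempty A›
  let W := insert a0 V
  refine ⟨W.card, fun i => (W.equivFin.symm i : A),
    fun i => if h : i ∈ W then W.equivFin ⟨i, h⟩ else W.equivFin ⟨a0, by simp [W]⟩, ?_⟩
  intro i hi
  have : i ∈ W := by simp [W, hi]
  simp [this]

lemma realize_congr_free {α : Type*} [DecidableEq α] {K : Type*} [L.Structure K] (χ : L.Formula α)
    (v v' : α → K) (h : ∀ i ∈ χ.freeVarFinset, v i = v' i) : χ.Realize v ↔ χ.Realize v' := by
  have h1 := BoundedFormula.realize_restrictFreeVar (φ := χ) (f := fun i => (i : α)) (v := v)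
    (xs := default) v (fun _ => rfl)
  have h2 := BoundedFormula.realize_restrictFreeVar (φ := χ) (f := fun i => (i : α)) (v := v)
    (xs := default) v' (fun a => h a a.2)
  exact h1.symm.trans h2

lemma exists_finite_support {A B : Type*} [Nonempty A] [Nonempty B] (χ : L.Formula (A ⊕ B)) :
    ∃ (k n : ℕ) (a : Fin k → A) (g : A → Fin k) (b : Fin n → B) (h : B → Fin n),
      ∀ (K : Type (max u v)) [L.Structure K] (x : A → K) (y : B → K),
        (χ.Realize (Sum.elim (x ∘ a ∘ g) y) ↔ χ.Realize (Sum.elim x y)) ∧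
        (χ.Realize (Sum.elim x (y ∘ b ∘ h)) ↔ χ.Realize (Sum.elim x y)) := by
  classical
  obtain ⟨k, a, g, hag⟩ := exists_fin_retract
    (χ.freeVarFinset.preimage (Sum.inl : A → A ⊕ B) Sum.inl_injective.injOn)
  obtain ⟨n, b, h, hbh⟩ := exists_fin_retract
    (χ.freeVarFinset.preimage (Sum.inr : B → A ⊕ B) Sum.inr_injective.injOn)
  refine ⟨k, n, a, g, b, h, fun K _ x y => ⟨?_, ?_⟩⟩
  · apply realize_congr_free
    rintro (i | i) hi
    · simp [hag i (by simpa using hi)]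
    · rfl
  · apply realize_congr_free
    rintro (i | i) hi
    · rfl
    · simp [hbh i (by simpa using hi)]

lemma exists_AE {A B : Type*} [Nonempty A] [Nonempty B] (χ : L.Formula (A ⊕ B)) (hχ : χ.IsQF) :
    ∃ σ : L.Sentence, IsAESentence σ ∧ ∀ (K : Type (max u v)) [L.Structure K],
      K ⊨ σ ↔ ∀ x : A → K, ∃ y : B → K, χ.Realize (Sum.elim x y) := by
  obtain ⟨k, n, a, g, b, h, H⟩ := exists_finite_support χ
  let χ' : L.BoundedFormula Empty (k + n) :=
    BoundedFormula.relabel (n := k + n) (k := 0)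
      (fun i : A ⊕ B => Sum.inr (Sum.elim (Fin.castAdd n ∘ g) (Fin.natAdd k ∘ h) i)) χ
  refine ⟨(BoundedFormula.exsAux χ').alls, ⟨k, n, χ', hχ.relabel _, rfl⟩, fun K _ => ?_⟩
  have key : ∀ (xs : Fin k → K) (ys : Fin n → K) (v : Empty → K),
      χ'.Realize v (Fin.append xs ys) ↔ χ.Realize (Sum.elim (xs ∘ g) (ys ∘ h)) := by
    intro xs ys v
    refine BoundedFormula.realize_relabel.trans ?_
    rw [Formula.Realize]
    refine iff_of_eq ?_
    congr 1
    · funext i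
      rcases i with i | i
      · simp
      · simp
    · exact Subsingleton.elim _ _
  rw [Sentence.Realize, BoundedFormula.realize_alls]
  simp only [realize_exsAux, key]
  constructor
  · intro hh x
    obtain ⟨ys, hy⟩ := hh (x ∘ a)
    exact ⟨ys ∘ h, (H K x (ys ∘ h)).1.1 hy⟩
  · intro hh xs
    obtain ⟨y, hy⟩ := hh (xs ∘ g)
    exact ⟨y ∘ b, (H K (xs ∘ g) y).2.2 hy⟩

lemma IsECVia.exists_realize {M N : Type (max u v)} [L.Structure M] [L.Structure N]
    {f : M ↪[L] N} (hf : IsECVia f) {A B : Type*} [Nonempty A] [Nonempty B]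
    (χ : L.Formula (A ⊕ B)) (hχ : χ.IsQF) (x : A → M) (y : B → N)
    (hxy : χ.Realize (Sum.elim (f ∘ x) y)) : ∃ y' : B → M, χ.Realize (Sum.elim x y') := by
  obtain ⟨k, n, a, g, b, h, H⟩ := exists_finite_support χ
  let χ' : L.BoundedFormula (Fin k) n :=
    BoundedFormula.relabel (n := n) (k := 0) (Sum.map g h) χ
  have key : ∀ (K : Type (max u v)) [L.Structure K] (xs : Fin k → K) (ys : Fin n → K),
      χ'.Realize xs ys ↔ χ.Realize (Sum.elim (xs ∘ g) (ys ∘ h)) := by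
    intro K _ xs ys
    refine BoundedFormula.realize_relabel.trans ?_
    rw [Formula.Realize]
    refine iff_of_eq ?_
    congr 1
    · funext i
      rcases i with i | i
      · simp
      · simp
    · exact Subsingleton.elim _ _
  have h1 := hf k χ'.exs ⟨n, χ', hχ.relabel _, rfl⟩ (x ∘ a) ?_
  · obtain ⟨ys, hys⟩ := BoundedFormula.realize_exs.1 h1
    exact ⟨ys ∘ h, (H M x (ys ∘ h)).1.1 ((key M _ _).1 hys)⟩
  · refine BoundedFormula.realize_exs.2 ⟨y ∘ b, (key N _ _).2 ?_⟩
    exact (H N (f ∘ x) (y ∘ b ∘ h)).1.2 ((H N (f ∘ x) y).2.2 hxy)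

lemma exists_embedding {M K : Type (max u v)} [L.Structure M] [L.Structure K] (x : M → K)
    (h : ∀ ψ : L.Formula M, ψ.IsQF → ψ.Realize id → ψ.Realize x) :
    ∃ f : M ↪[L] K, ⇑f = x := by
  refine ⟨⟨⟨x, ?_⟩, ?_, ?_⟩, rfl⟩
  · intro m m' hmm
    by_contra hne
    have := h (((Term.var m).equal (Term.var m')).not) (.not (.of_isAtomic (.equal _ _)))
      (by simpa using hne)
    simp at this
    exact this hmm
  · intro n F xs
    have := h ((Term.func F (fun i => Term.var (xs i))).equal (Term.var (Structure.funMap F xs)))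
      (.of_isAtomic (.equal _ _)) (by simp)
    simp at this
    exact this.symm
  · intro n R xs
    constructor
    · intro hr
      by_contra hne
      have := h ((R.formula (fun i => Term.var (xs i))).not) (.not (.of_isAtomic (.rel _ _)))
        (by simpa [Formula.realize_rel] using hne)
      simp [Formula.realize_rel] at this
      exact this hr
    · intro hr
      have := h (R.formula (fun i => Term.var (xs i))) (.of_isAtomic (.rel _ _))
        (by simpa [Formula.realize_rel] using hr)
      simp only [Formula.realize_rel] at this
      exact this

lemma formula_compactness {α : Type (max u v)} (S : Set (L.Formula α))
    (h : ∀ F : Finset (L.Formula α), (F : Set (L.Formula α)) ⊆ S →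
      ∃ (K : Type (max u v)) (_ : L.Structure K) (_ : Nonempty K) (x : α → K),
        ∀ φ ∈ F, φ.Realize x) :
    ∃ (K : Type (max u v)) (_ : L.Structure K) (_ : Nonempty K) (x : α → K),
        ∀ φ ∈ S, φ.Realize x := by
  classical
  have hs : Theory.IsSatisfiable (Formula.equivSentence '' S : (L[[α]]).Theory) := by
    rw [Theory.isSatisfiable_iff_isFinitelySatisfiable]
    intro T0 hT0
    obtain ⟨K, _, _, x, hx⟩ := h (T0.image Formula.equivSentence.symm) (by
      intro φ hφ
      simp only [Finset.coe_image, Set.mem_image] at hφ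
      obtain ⟨σ, hσ, rfl⟩ := hφ
      obtain ⟨ψ, hψ, rfl⟩ := hT0 hσ
      simpa using hψ)
    let := constantsOn.structure x
    have : Theory.Model K (T0 : (L[[α]]).Theory) := ⟨fun σ hσ =>
      (Formula.realize_equivSentence_symm K σ x).1 (hx _ (Finset.mem_image_of_mem _ hσ))⟩
    exact ⟨Theory.ModelType.of _ K⟩
  obtain ⟨K⟩ := hs
  let := (L.lhomWithConstants α).reduct K
  refine ⟨K, inferInstance, inferInstance, fun a => (L.con a : K), fun φ hφ => ?_⟩
  rw [← Formula.realize_equivSentence]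
  exact Theory.realize_sentence_of_mem (Formula.equivSentence '' S) (Set.mem_image_of_mem _ hφ)

/-- Every structure satisfying the ∀∃ consequences of `T` is existentially closed in some
model of `T`. -/
lemma exists_ec_extension (T : L.Theory) (M : Type (max u v)) [L.Structure M] [Nonempty M]
    (hM : ∀ φ : L.Sentence, IsAESentence φ → T ⊨ᵇ φ → M ⊨ φ) :
    ∃ (N : Type (max u v)) (_ : L.Structure N) (_ : Nonempty N) (f : M ↪[L] N),
      N ⊨ T ∧ IsECVia f := by
  classical
  let P : L.Formula M → L.Formula (M ⊕ ℕ) → Prop := fun φ χ => χ.IsQF ∧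
    ∀ (K : Type (max u v)) [L.Structure K] [Nonempty K] (x : M → K),
      φ.Realize x ↔ ∀ y : ℕ → K, χ.Realize (Sum.elim x y)
  let S : Set (L.Formula M) := {φ | φ.Realize (id : M → M) ∧ ∃ χ, P φ χ}
  let S' : Set (L.Formula M) :=
    (fun σ : L.Sentence => Formula.relabel (Empty.elim : Empty → M) σ) '' T
  obtain ⟨K, _, _, x, hx⟩ := formula_compactness (S ∪ S') (by
    intro F hF
    have hconj : ∀ F : Finset (L.Formula M), ∃ χ : L.Formula (M ⊕ ℕ), χ.IsQF ∧
        ∀ (K : Type (max u v)) [L.Structure K] [Nonempty K] (x : M → K),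
          (∀ φ ∈ F, φ ∈ S → φ.Realize x) ↔ ∀ y : ℕ → K, χ.Realize (Sum.elim x y) := by
      intro F
      induction F using Finset.induction_on with
      | empty => exact ⟨⊤, BoundedFormula.IsQF.top, by simp⟩
      | insert φ F _ ih =>
        obtain ⟨χ, hχ, h⟩ := ih
        by_cases hφ : φ ∈ S
        · obtain ⟨χ', hχ', h'⟩ := hφ.2
          refine ⟨χ ⊓ χ', hχ.inf hχ', fun K _ _ x => ?_⟩
          have e1 := h K x
          have e2 := h' K x
          simp only [Formula.realize_inf, forall_and, ← e1, ← e2, Finset.mem_insert,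
            forall_eq_or_imp, hφ, forall_const]
          exact and_comm
        · refine ⟨χ, hχ, fun K _ _ x => ?_⟩
          rw [← h K x]
          simp [hφ]
    obtain ⟨χ, hχ, H⟩ := hconj F
    by_contra hcon
    push Not at hcon
    obtain ⟨σ, hσ, hσr⟩ := exists_AE χ.not hχ.not
    have hMσ : M ⊨ σ := by
      refine hM σ hσ (Theory.models_sentence_iff.2 fun K => (hσr K).2 fun x => ?_)
      obtain ⟨φ, hφ, hφx⟩ := hcon K inferInstance inferInstance x
      have hφS : φ ∈ S := by
        rcases hF hφ with h | ⟨σ', hσ', rfl⟩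
        · exact h
        · exfalso
          apply hφx
          rw [Formula.realize_relabel]
          have := Theory.realize_sentence_of_mem (M := K) T hσ'
          rw [Sentence.Realize] at this
          convert this
      by_contra hno
      push Not at hno
      refine hφx ((H K x).2 (fun y => ?_) φ hφ hφS)
      simpa using hno y
    obtain ⟨y, hy⟩ := (hσr M).1 hMσ id
    exact hy ((H M id).1 (fun φ _ h => h.1) y))
  obtain ⟨f, hf⟩ := exists_embedding x (fun ψ hψ hψr => hx ψ (Or.inl ⟨hψr,
    Formula.relabel Sum.inl ψ, hψ.relabel _, fun K _ _ x => by simp⟩))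
  refine ⟨K, inferInstance, inferInstance, f, ⟨fun σ hσ => ?_⟩, ?_⟩
  · have := hx _ (Or.inr ⟨σ, hσ, rfl⟩)
    rw [Formula.realize_relabel] at this
    rw [Sentence.Realize]
    convert this
  · rintro k φ ⟨n, χ, hχ, rfl⟩ a hK
    by_contra hno
    have := hx (Formula.relabel a (Formula.not χ.exs)) (Or.inl ⟨?_,
      Formula.relabel (Sum.map a (fun i : Fin n => (i : ℕ))) χ.toFormula.not,
      (isQF_toFormula hχ).not.relabel _, ?_⟩)
    · rw [Formula.realize_relabel, Formula.realize_not] at this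
      rw [hf] at hK
      exact this hK
    · rw [Formula.realize_relabel, Formula.realize_not]
      exact hno
    · intro K' _ _ x'
      rw [Formula.realize_relabel, Formula.realize_not,
        BoundedFormula.realize_exs]
      push Not
      constructor
      · intro h y
        rw [Formula.realize_relabel, Formula.realize_not, BoundedFormula.realize_toFormula]
        exact h (fun i => y i)
      · intro h xs
        have := h (fun i => if hi : i < n then xs ⟨i, hi⟩ else Classical.arbitrary K')
        rw [Formula.realize_relabel, Formula.realize_not, BoundedFormula.realize_toFormula] at this
        convert this using 3
        · funext i
          simp
        · funext i
          simp

/-- If `M` is existentially closed in `N`, then `N` embeds over `M` in an elementary extension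
of `M`. -/
lemma exists_elementary_amalgam {M N : Type (max u v)} [L.Structure M] [L.Structure N]
    [Nonempty M] [Nonempty N] (f : M ↪[L] N) (hf : IsECVia f) :
    ∃ (M' : Type (max u v)) (_ : L.Structure M') (_ : Nonempty M') (e : M ↪ₑ[L] M')
      (g : N ↪[L] M'), ∀ m, g (f m) = e m := by
  classical
  let S : Set (L.Formula N) := {φ | φ.IsQF ∧ φ.Realize (id : N → N)}
  let S' : Set (L.Formula N) := (fun φ : L.Formula M => φ.relabel f) '' {φ | φ.Realize (id : M → M)}
  obtain ⟨K, _, _, x, hx⟩ := formula_compactness (S ∪ S') (by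
    intro F hF
    have hconj : ∀ F : Finset (L.Formula N), ∃ χ : L.Formula N, χ.IsQF ∧
        ∀ (K : Type (max u v)) [L.Structure K] (x : N → K),
          (∀ φ ∈ F, φ ∈ S → φ.Realize x) ↔ χ.Realize x := by
      intro F
      induction F using Finset.induction_on with
      | empty => exact ⟨⊤, BoundedFormula.IsQF.top, by simp⟩
      | insert φ F _ ih =>
        obtain ⟨χ, hχ, h⟩ := ih
        by_cases hφ : φ ∈ S
        · refine ⟨χ ⊓ φ, hχ.inf hφ.1, fun K _ x => ?_⟩
          have e1 := h K x
          simp only [Formula.realize_inf, ← e1, Finset.mem_insert,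
            forall_eq_or_imp, hφ, forall_const]
          exact and_comm
        · refine ⟨χ, hχ, fun K _ x => ?_⟩
          rw [← h K x]
          simp [hφ]
    obtain ⟨χ, hχ, H⟩ := hconj F
    let c : N → M ⊕ N := fun n => if h : ∃ m, f m = n then Sum.inl h.choose else Sum.inr n
    have hc : ∀ m, c (f m) = Sum.inl m := by
      intro m
      have h : ∃ m', f m' = f m := ⟨m, rfl⟩
      simp only [c, dif_pos h]
      rw [f.injective h.choose_spec]
    have hc' : ∀ n, Sum.elim f id (c n) = n := by
      intro n
      by_cases h : ∃ m, f m = n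
      · simp only [c, dif_pos h, Sum.elim_inl]
        exact h.choose_spec
      · simp only [c, dif_neg h, Sum.elim_inr, id]
    obtain ⟨y, hy⟩ := hf.exists_realize (Formula.relabel c χ) (hχ.relabel _) id id (by
      rw [Formula.realize_relabel]
      have : (Sum.elim (f ∘ id) id ∘ c : N → N) = id := funext hc'
      rw [this]
      exact (H N id).1 fun φ _ h => h.2)
    rw [Formula.realize_relabel] at hy
    refine ⟨M, inferInstance, inferInstance, Sum.elim id y ∘ c, fun φ hφ => ?_⟩
    rcases hF hφ with h | ⟨ψ, hψ, rfl⟩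
    · exact (H M _).2 hy φ hφ h
    · rw [Formula.realize_relabel]
      have : ((Sum.elim id y ∘ c) ∘ f : M → M) = id := by
        funext m
        simp [hc]
      rw [this]
      exact hψ)
  obtain ⟨g, hg⟩ := exists_embedding x (fun ψ hψ hψr => hx ψ (Or.inl ⟨hψ, hψr⟩))
  have hel : ∀ φ : L.Formula M, φ.Realize (id : M → M) → φ.Realize (x ∘ f) := fun φ hφ =>
    Formula.realize_relabel.1 (hx _ (Or.inr ⟨φ, hφ, rfl⟩))
  refine ⟨K, inferInstance, inferInstance, ⟨x ∘ f, ?_⟩, g, fun m => by rw [hg]; rfl⟩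
  intro n φ a
  constructor
  · intro h
    by_contra hno
    have := hel (Formula.relabel a φ.not) (by
      rw [Formula.realize_relabel, Formula.realize_not]; exact hno)
    rw [Formula.realize_relabel, Formula.realize_not] at this
    exact this h
  · intro h
    have := hel (Formula.relabel a φ) (by rw [Formula.realize_relabel]; exact h)
    rw [Formula.realize_relabel] at this
    exact this

lemma ec_realize_iff (T : L.Theory) (hT : IsModelComplete T) {n : ℕ}
    (φ : L.BoundedFormula Empty n) :
    ∀ (M N : Type (max u v)) [L.Structure M] [L.Structure N] [Nonempty M] [Nonempty N]
      (_ : ∀ φ : L.Sentence, IsAESentence φ → T ⊨ᵇ φ → M ⊨ φ) (_ : N ⊨ T)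
      (f : M ↪[L] N) (_ : IsECVia f) (xs : Fin n → M),
      φ.Realize default (f ∘ xs) ↔ φ.Realize default xs := by
  induction φ with
  | falsum => intros; rfl
  | equal t₁ t₂ =>
    intro M N _ _ _ _ _ _ f _ xs
    have := (BoundedFormula.IsQF.of_isAtomic (.equal t₁ t₂)).realize_embedding f
      (v := (default : Empty → M)) (xs := xs)
    rwa [Subsingleton.elim (f ∘ (default : Empty → M)) default] at this
  | rel R ts =>
    intro M N _ _ _ _ _ _ f _ xs
    have := (BoundedFormula.IsQF.of_isAtomic (.rel R ts)).realize_embedding f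
      (v := (default : Empty → M)) (xs := xs)
    rwa [Subsingleton.elim (f ∘ (default : Empty → M)) default] at this
  | imp _ _ ih1 ih2 =>
    intro M N _ _ _ _ hM hN f hf xs
    rw [BoundedFormula.realize_imp, BoundedFormula.realize_imp, ih1 M N hM hN f hf,
      ih2 M N hM hN f hf]
  | @all n φ ih =>
    intro M N _ _ _ _ hM hN f hf xs
    rw [BoundedFormula.realize_all, BoundedFormula.realize_all]
    constructor
    · intro h m
      rw [← ih M N hM hN f hf, Fin.comp_snoc]
      exact h _
    · intro h b
      obtain ⟨M', _, _, e, g, hge⟩ := exists_elementary_amalgam f hf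
      have hM' : ∀ φ : L.Sentence, IsAESentence φ → T ⊨ᵇ φ → M' ⊨ φ := fun φ h1 h2 =>
        (e.map_sentence φ).1 (hM φ h1 h2)
      obtain ⟨N', _, _, f', hN', hf'⟩ := exists_ec_extension T M' hM'
      let j : N ↪ₑ[L] N' := ⟨f'.comp g, fun n φ x => hT N N' hN hN' (f'.comp g) n φ x⟩
      rw [← j.map_boundedFormula φ]
      have hd : (j ∘ (default : Empty → N)) = default := Subsingleton.elim _ _
      have hxs : (j ∘ (Fin.snoc (f ∘ xs) b : Fin (n + 1) → N)) =
          f' ∘ (Fin.snoc (e ∘ xs) (g b) : Fin (n + 1) → M') := by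
        rw [Fin.comp_snoc, Fin.comp_snoc]
        congr 1
        funext i
        change f' (g (f (xs i))) = f' (e (xs i))
        rw [hge]
      rw [hd, hxs, ih M' N' hM' hN' f' hf']
      have hall : φ.all.Realize (default : Empty → M') (e ∘ xs) := by
        have := (e.map_boundedFormula φ.all default xs).2 (BoundedFormula.realize_all.2 h)
        rwa [Subsingleton.elim (e ∘ (default : Empty → M)) default] at this
      exact BoundedFormula.realize_all.1 hall _

end Helpers

/-- A model companion is axiomatized by its ∀∃ consequences: every structure satisfying
all ∀∃ sentences that are consequences of `Tstar` is a model of `Tstar`. -/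
theorem modelCompanion_axiomatized_by_AE (T Tstar : L.Theory)
    (h : IsModelCompanion T Tstar)
    (M : Type (max u v)) [L.Structure M] [Nonempty M]
    (hM : ∀ φ : L.Sentence, IsAESentence φ → Tstar ⊨ᵇ φ → M ⊨ φ) :
    M ⊨ Tstar := by
  obtain ⟨N, _, _, f, hN, hf⟩ := exists_ec_extension Tstar M hM
  refine ⟨fun σ hσ => ?_⟩
  have h1 := ec_realize_iff Tstar h.1 σ M N hM hN f hf default
  have h2 : N ⊨ σ := hN.realize_of_mem σ hσ
  refine h1.1 ?_
  rw [Subsingleton.elim (f ∘ default) default]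
  exact h2
end

section
/- (Existence criterion for the model companion) A first-order theory T has a model companion if and only if the class of existentially closed models of T_∀ is elementary, i.e., there exists an L-theory S such that the models of S are exactly the L-structures M with M ⊨ T_∀ that are existentially closed for T_∀. -/
open FirstOrder FirstOrder.Language

universe u v

variable {L : FirstOrder.Language.{u, v}}

namespace MCAux

open FirstOrder.Language.BoundedFormula

/-- `Γ` is realizable: some structure and assignment satisfy all its formulas. -/
def Realizable {α : Type (max u v)} (Γ : Set (L.Formula α)) : Prop :=
  ∃ (K : Type (max u v)) (_ : L.Structure K) (_ : Nonempty K) (w : α → K),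
    ∀ φ ∈ Γ, φ.Realize w

theorem compactness {α : Type (max u v)} (Γ : Set (L.Formula α))
    (h : ∀ s : Finset (L.Formula α), (s : Set (L.Formula α)) ⊆ Γ →
      Realizable (s : Set (L.Formula α))) : Realizable Γ := by
  classical
  have hs : Theory.IsSatisfiable (Formula.equivSentence '' Γ : L[[α]].Theory) := by
    rw [Theory.isSatisfiable_iff_isFinitelySatisfiable]
    intro T0 hT0
    obtain ⟨s, hs, rfl⟩ := Finset.subset_set_image_iff.1 hT0
    obtain ⟨K, _, _, w, hw⟩ := h s hs
    let := constantsOn.structure w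
    have : K ⊨ ((Finset.image Formula.equivSentence s : Finset L[[α]].Sentence) :
        L[[α]].Theory) := by
      refine ⟨fun φ hφ => ?_⟩
      simp only [Finset.coe_image, Set.mem_image, Finset.mem_coe] at hφ
      obtain ⟨ψ, hψ, rfl⟩ := hφ
      rw [← Formula.realize_equivSentence_symm K _ w, Equiv.symm_apply_apply]
      exact hw ψ hψ
    exact Theory.Model.isSatisfiable K
  obtain ⟨K⟩ := hs
  let : L.Structure K := (L.lhomWithConstants α).reduct K
  have : (L.lhomWithConstants α).IsExpansionOn K := LHom.isExpansionOn_reduct _ _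
  refine ⟨K, inferInstance, inferInstance, fun a => (L.con a : K), fun φ hφ => ?_⟩
  rw [← Formula.realize_equivSentence]
  exact Theory.realize_sentence_of_mem (Formula.equivSentence '' Γ : L[[α]].Theory)
    ⟨φ, hφ, rfl⟩

/-- The quantifier-free diagram, as a set of formulas with variables in `N`. -/
def diag (N : Type (max u v)) [L.Structure N] : Set (L.Formula N) :=
  {θ | θ.IsQF ∧ θ.Realize (id : N → N)}

/-- Sentences as formulas with arbitrary variables. -/
def thySet (T : L.Theory) (α : Type (max u v)) : Set (L.Formula α) :=
  (Formula.relabel (Empty.elim : Empty → α)) '' T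

theorem realize_thySet {T : L.Theory} {α : Type (max u v)} {K : Type (max u v)} [L.Structure K]
    {w : α → K} : (∀ φ ∈ thySet T α, φ.Realize w) ↔ K ⊨ T := by
  simp only [thySet, Set.mem_image, forall_exists_index, and_imp, forall_apply_eq_imp_iff₂,
    Formula.realize_relabel, Theory.model_iff, Sentence.Realize]
  refine forall₂_congr fun φ _ => ?_
  rw [Subsingleton.elim (w ∘ Empty.elim) default]

theorem diag_compactness {N : Type (max u v)} [L.Structure N] (W : Set (L.Formula N))
    (h : ∀ θ ∈ diag N, Realizable (insert θ W)) : Realizable (diag N ∪ W) := by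
  classical
  apply compactness
  intro s hs
  let l := (s.filter (· ∈ diag N)).toList
  have hl : ∀ φ ∈ l, φ ∈ diag N := fun φ hφ => by
    simp only [l, Finset.mem_toList, Finset.mem_filter] at hφ; exact hφ.2
  have hQ : ∀ l : List (L.Formula N), (∀ φ ∈ l, φ ∈ diag N) →
      IsQF (l.foldr (· ⊓ ·) (⊤ : L.BoundedFormula N 0)) := by
    intro l
    induction l with
    | nil => intro _; exact IsQF.top
    | cons a l ih =>
      intro h
      exact IsQF.inf (h a (by simp)).1 (ih fun φ hφ => h φ (by simp [hφ]))
  obtain ⟨K, i1, i2, w, hw⟩ := h (l.foldr (· ⊓ ·) (⊤ : L.BoundedFormula N 0))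
    ⟨hQ l hl, (realize_foldr_inf l _ _).2 fun φ hφ => (hl φ hφ).2⟩
  refine ⟨K, i1, i2, w, fun φ hφ => ?_⟩
  by_cases hd : φ ∈ diag N
  · exact (realize_foldr_inf l _ _).1 (hw _ (Set.mem_insert _ _)) φ
      (by simp [l, hd]; exact hφ)
  · exact hw _ (Set.mem_insert_of_mem _ ((hs hφ).resolve_left hd))

theorem exists_embedding {N K : Type (max u v)} [L.Structure N] [L.Structure K] (w : N → K)
    (hw : ∀ θ ∈ diag (L := L) N, θ.Realize w) : ∃ f : N ↪[L] K, (f : N → K) = w := by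
  have key : ∀ θ : L.Formula N, θ.IsQF → (θ.Realize w ↔ θ.Realize (id : N → N)) := by
    intro θ hθ
    refine ⟨fun h => ?_, fun h => hw θ ⟨hθ, h⟩⟩
    by_contra hn
    have := hw θ.not ⟨hθ.not, by rwa [Formula.realize_not]⟩
    rw [Formula.realize_not] at this
    exact this h
  refine ⟨⟨⟨w, fun a b hab => ?_⟩, fun {n} F x => ?_, fun {n} R x => ?_⟩, rfl⟩
  · have := key ((Term.var a).equal (Term.var b)) (IsAtomic.equal _ _).isQF
    rw [Formula.realize_equal, Formula.realize_equal] at this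
    exact this.1 hab
  · have := key ((Term.var (Structure.funMap F x)).equal (Term.func F fun i => Term.var (x i)))
      (IsAtomic.equal _ _).isQF
    rw [Formula.realize_equal, Formula.realize_equal] at this
    exact this.2 rfl
  · have := key (R.formula fun i => Term.var (x i)) (IsAtomic.rel _ _).isQF
    rw [Formula.realize_rel, Formula.realize_rel] at this
    exact this

theorem isQF_restrictFreeVar {α β : Type*} [DecidableEq α] {n : ℕ} {φ : L.BoundedFormula α n}
    (h : φ.IsQF) (f : φ.freeVarFinset → β) : (φ.restrictFreeVar f).IsQF := by
  induction h with
  | falsum => exact IsQF.falsum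
  | of_isAtomic h =>
    cases h with
    | equal t₁ t₂ => exact (IsAtomic.equal _ _).isQF
    | rel R ts => exact (IsAtomic.rel _ _).isQF
  | imp h1 h2 ih1 ih2 => exact (ih1 _).imp (ih2 _)

theorem finite_vars {α : Type*} (θ : L.Formula α) (hθ : θ.IsQF) :
    ∃ (n : ℕ) (c : Fin n → α) (θ' : L.Formula (Fin n)), Function.Injective c ∧ θ'.IsQF ∧
      ∀ (K : Type (max u v)) [L.Structure K] (w : α → K) (w' : Fin n → K),
        (∀ i, w' i = w (c i)) → (θ'.Realize w' ↔ θ.Realize w) := by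
  classical
  let e := θ.freeVarFinset.equivFin
  refine ⟨_, fun i => (e.symm i : α), θ.restrictFreeVar e,
    Subtype.val_injective.comp e.symm.injective, isQF_restrictFreeVar hθ _, ?_⟩
  intro K _ w w' h
  exact realize_restrictFreeVar w (fun a => by simp only [h, Equiv.symm_apply_apply])

/-- Finite tuples of an existentially closed structure. -/
theorem ec_pullback {M N : Type (max u v)} [L.Structure M] [L.Structure N] [Nonempty M]
    (f : M ↪[L] N) (hf : IsECVia f) (θ : L.Formula N) (hθ : θ ∈ diag N) :
    ∃ w : N → M, θ.Realize w ∧ ∀ m, w (f m) = m := by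
  classical
  obtain ⟨n, c, θ', hc, hQ, hr⟩ := finite_vars θ hθ.1
  have hr0 := (hr N id c fun _ => rfl).2 hθ.2
  let g : Fin n → Fin n ⊕ Fin n := fun i => if c i ∈ Set.range f then .inl i else .inr i
  let x : Fin n → M := fun i => Function.invFun f (c i)
  have hfx : ∀ i, c i ∈ Set.range f → f (x i) = c i := fun i hi => Function.invFun_eq hi
  let χ : L.BoundedFormula (Fin n) n := BoundedFormula.relabel (k := 0) g θ'
  have hχ : ∀ (K : Type (max u v)) [L.Structure K] (y z : Fin n → K),
      χ.Realize y z ↔ θ'.Realize (Sum.elim y z ∘ g) := by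
    intro K _ y z
    refine (realize_relabel (m := n) (n := 0)).trans ?_
    unfold Formula.Realize
    exact iff_of_eq (congrArg _ (Subsingleton.elim _ _))
  have := hf n χ.exs ⟨n, χ, hQ.relabel g, rfl⟩ x
    (realize_exs.2 ⟨c, (hχ N _ _).2 (by
      convert hr0 using 1
      funext i
      by_cases hi : c i ∈ Set.range f
      · simp only [Function.comp, g, if_pos hi, Sum.elim_inl]; exact hfx i hi
      · simp only [Function.comp, g, if_neg hi, Sum.elim_inr])⟩)
  obtain ⟨z, hz⟩ := realize_exs.1 this
  rw [hχ] at hz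
  let w : N → M := fun b => if b ∈ Set.range f then Function.invFun f b else
    Function.extend c z (fun _ => Classical.arbitrary M) b
  refine ⟨w, (hr M w _ fun i => ?_).1 hz, fun m => ?_⟩
  · by_cases hi : c i ∈ Set.range f
    · simp only [Function.comp, g, if_pos hi, Sum.elim_inl, w, x]
    · simp only [Function.comp, g, if_neg hi, Sum.elim_inr, w, hc.extend_apply]
  · simp only [w, if_pos (Set.mem_range_self m)]
    exact Function.leftInverse_invFun f.injective m

/-- Existential formulas go up, universal sentences go down. -/
theorem existential_up {M N : Type (max u v)} [L.Structure M] [L.Structure N] (f : M ↪[L] N)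
    {α : Type*} {φ : L.Formula α} (hφ : IsExistentialFormula φ) {x : α → M}
    (h : φ.Realize x) : φ.Realize (f ∘ x) := by
  obtain ⟨n, χ, hQ, rfl⟩ := hφ
  obtain ⟨z, hz⟩ := realize_exs.1 h
  exact realize_exs.2 ⟨f ∘ z, (hQ.realize_embedding f).2 hz⟩

theorem universal_down {M N : Type (max u v)} [L.Structure M] [L.Structure N] (f : M ↪[L] N)
    (T : L.Theory) (h : N ⊨ universalPart T) : M ⊨ universalPart T := by
  refine ⟨fun φ hφ => ?_⟩
  have h1 := h.realize_of_mem φ hφ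
  obtain ⟨⟨n, χ, hQ, rfl⟩, -⟩ := hφ
  refine realize_alls.2 fun z => ?_
  have := realize_alls.1 h1 (f ∘ z)
  rw [Subsingleton.elim default (f ∘ (default : Empty → M)), hQ.realize_embedding f] at this
  exact this

theorem models_universalPart {N : Type (max u v)} [L.Structure N] [Nonempty N]
    (T : L.Theory) (h : N ⊨ T) : N ⊨ universalPart T := by
  refine ⟨fun φ hφ => ?_⟩
  exact Theory.models_sentence_iff.1 hφ.2 (Theory.ModelType.of T N)

theorem embeds_in_model {M : Type (max u v)} [L.Structure M] [Nonempty M]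
    (T : L.Theory) (h : M ⊨ universalPart T) :
    ∃ (N : Type (max u v)) (_ : L.Structure N) (_ : Nonempty N),
       N ⊨ T ∧ Nonempty (M ↪[L] N) := by
  obtain ⟨K, i1, i2, w, hw⟩ := diag_compactness (thySet T M) (by
    intro θ hθ
    by_contra hcon
    obtain ⟨n, c, θ', hc, hQ, hr⟩ := finite_vars θ hθ.1
    let χ : L.BoundedFormula Empty n := BoundedFormula.relabel (k := 0) Sum.inr θ'
    have hmem : (χ.not.alls : L.Sentence) ∈ universalPart T := by
      refine ⟨⟨n, χ.not, (hQ.relabel _).not, rfl⟩, ?_⟩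
      rw [Theory.models_sentence_iff]
      intro K
      refine realize_alls.2 fun z => ?_
      rw [realize_not]
      intro hz
      have hz' : θ'.Realize z := (Formula.realize_relabel_sumInr θ').1 hz
      let w : M → K := Function.extend c z (fun _ => Classical.arbitrary K)
      refine hcon ⟨K, inferInstance, inferInstance, w, ?_⟩
      intro φ hφ
      rcases hφ with rfl | hφ
      · exact (hr K w z fun i => (hc.extend_apply _ _ i).symm).1 hz'
      · exact realize_thySet.2 K.is_model φ hφ
    have := realize_alls.1 (h.realize_of_mem _ hmem) c
    rw [realize_not] at this
    exact this ((Formula.realize_relabel_sumInr θ').2 ((hr M id c fun _ => rfl).2 hθ.2)))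
  obtain ⟨f, -⟩ := exists_embedding w fun θ hθ => hw θ (.inl hθ)
  exact ⟨K, i1, i2, realize_thySet.1 fun φ hφ => hw φ (.inr hφ), ⟨f⟩⟩

theorem ec_amalgam {M N : Type (max u v)} [L.Structure M] [L.Structure N] [Nonempty M]
    (f : M ↪[L] N) (hf : IsECVia f) :
    ∃ (K : Type (max u v)) (_ : L.Structure K) (_ : Nonempty K) (g : N ↪[L] K),
      ∀ φ : L.Formula M, φ.Realize (g ∘ f) ↔ φ.Realize (id : M → M) := by
  obtain ⟨K, i1, i2, w, hw⟩ := diag_compactness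
    {ψ : L.Formula N | ∃ φ : L.Formula M, φ.Realize (id : M → M) ∧ ψ = φ.relabel f} (by
      intro θ hθ
      obtain ⟨w, hw, hwf⟩ := ec_pullback f hf θ hθ
      refine ⟨M, inferInstance, inferInstance, w, ?_⟩
      rintro ψ (rfl | ⟨φ, hφ, rfl⟩)
      · exact hw
      · rw [Formula.realize_relabel, show w ∘ f = id from funext hwf]
        exact hφ)
  obtain ⟨g, rfl⟩ := exists_embedding w fun θ hθ => hw θ (.inl hθ)
  have key : ∀ φ : L.Formula M, φ.Realize (id : M → M) → φ.Realize (g ∘ f) := fun φ hφ => by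
    have := hw _ (.inr ⟨φ, hφ, rfl⟩)
    rwa [Formula.realize_relabel] at this
  refine ⟨K, i1, i2, g, fun φ => ⟨fun h => ?_, key φ⟩⟩
  by_contra hn
  have := key φ.not (by rwa [Formula.realize_not])
  rw [Formula.realize_not] at this
  exact this h

theorem amalgam_bounded {M K : Type (max u v)} [L.Structure M] [L.Structure K] (j : M → K)
    (h : ∀ φ : L.Formula M, φ.Realize j ↔ φ.Realize (id : M → M)) {α : Type*} {n : ℕ}
    (φ : L.BoundedFormula α n) (a : α → M) (xs : Fin n → M) :
    φ.Realize (j ∘ a) (j ∘ xs) ↔ φ.Realize a xs := by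
  have := h (φ.toFormula.relabel (Sum.elim a xs))
  simp only [Formula.realize_relabel, realize_toFormula] at this
  exact this

theorem elementary_of_ec (S : L.Theory)
    (hS : ∀ (M N : Type (max u v)) [L.Structure M] [L.Structure N] [Nonempty M] [Nonempty N],
      M ⊨ S → N ⊨ S → ∀ f : M ↪[L] N, IsECVia f) {α : Type*} {n : ℕ}
    (φ : L.BoundedFormula α n) :
    ∀ (M N : Type (max u v)) [L.Structure M] [L.Structure N] [Nonempty M] [Nonempty N],
      M ⊨ S → N ⊨ S → ∀ (f : M ↪[L] N) (a : α → M) (xs : Fin n → M),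
        φ.Realize (f ∘ a) (f ∘ xs) ↔ φ.Realize a xs := by
  induction φ with
  | falsum => intros; rfl
  | equal t₁ t₂ =>
    intro M N _ _ _ _ _ _ f a xs
    exact (IsAtomic.equal t₁ t₂).isQF.realize_embedding f
  | rel R ts =>
    intro M N _ _ _ _ _ _ f a xs
    exact (IsAtomic.rel R ts).isQF.realize_embedding f
  | imp φ ψ ih1 ih2 =>
    intro M N _ _ _ _ hM hN f a xs
    rw [realize_imp, realize_imp, ih1 M N hM hN f, ih2 M N hM hN f]
  | all φ ih =>
    intro M N _ _ _ _ hM hN f a xs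
    constructor
    · intro h m
      rw [← ih M N hM hN f, Fin.comp_snoc]
      exact h (f m)
    · intro h b
      obtain ⟨K, _, _, g, hg⟩ := ec_amalgam f (hS M N hM hN f)
      have hK : K ⊨ S := by
        refine ⟨fun σ hσ => ?_⟩
        have := (amalgam_bounded (g ∘ f) hg σ default default).2 (hM.realize_of_mem σ hσ)
        rwa [Subsingleton.elim ((g ∘ f) ∘ (default : Empty → M)) default,
          Subsingleton.elim ((g ∘ f) ∘ (default : Fin 0 → M)) default] at this
      have h1 := (amalgam_bounded (g ∘ f) hg φ.all a xs).2 h (g b)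
      rw [← ih N K hN hK g, Fin.comp_snoc]
      exact h1

theorem ec_models_companion (T Ts : L.Theory) (h : IsModelCompanion T Ts)
    (M : Type (max u v)) [L.Structure M] [Nonempty M] (hM : IsECFor (universalPart T) M) :
    M ⊨ Ts := by
  obtain ⟨hmc, h1, h2⟩ := h
  obtain ⟨N0, _, _, hN0, ⟨f0⟩⟩ := embeds_in_model T hM.1
  obtain ⟨N, _, _, hN, ⟨f1⟩⟩ := h1 N0 hN0
  let f : M ↪[L] N := f1.comp f0
  have hNU : N ⊨ universalPart T := by
    obtain ⟨N', _, _, hN', ⟨g⟩⟩ := h2 N hN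
    exact universal_down g T (models_universalPart T hN')
  have hf := hM.2 N hNU f
  have htv : ∀ (n : ℕ) (φ : L.BoundedFormula Empty (n + 1)) (x : Fin n → M) (a : N),
        φ.Realize default (Fin.snoc (f ∘ x) a : _ → N) →
          ∃ b : M, φ.Realize default (Fin.snoc (f ∘ x) (f b) : _ → N) := by
    intro n φ x a hφ
    let p : Empty ⊕ Fin (n + 1) → N := Sum.elim Empty.elim (Fin.snoc (f ∘ x) a : Fin (n + 1) → N)
    let ψ : L.Formula N := φ.toFormula.relabel p
    have hψ : ψ.Realize (id : N → N) := by
      simp only [ψ, Formula.realize_relabel, realize_toFormula]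
      convert hφ using 1
      rfl
    obtain ⟨θ, hθ, hθn⟩ : ∃ θ ∈ diag (L := L) N,
        ¬ Realizable (insert θ (insert ψ.not (thySet Ts N))) := by
      by_contra hcon
      push Not at hcon
      obtain ⟨K, _, _, w, hw⟩ := diag_compactness _ hcon
      obtain ⟨g, rfl⟩ := exists_embedding w fun θ hθ => hw θ (.inl hθ)
      have hK : K ⊨ Ts := realize_thySet.1 fun φ hφ => hw φ (.inr (.inr hφ))
      let ge : N ↪ₑ[L] K := ⟨g, hmc N K hN hK g⟩
      have h3 := hw _ (.inr (.inl rfl))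
      rw [Formula.realize_not] at h3
      exact h3 ((ge.map_formula ψ id).2 hψ)
    obtain ⟨w, hw, hwf⟩ := ec_pullback f hf θ hθ
    refine ⟨w a, ?_⟩
    by_contra hn
    refine hθn ⟨N, inferInstance, inferInstance, f ∘ w, ?_⟩
    rintro χ (rfl | rfl | hχ)
    · have := (hθ.1.realize_embedding f (v := w) (xs := default)).2 hw
      rwa [Subsingleton.elim (f ∘ (default : Fin 0 → M)) default] at this
    · rw [Formula.realize_not]
      intro h4
      simp only [ψ, Formula.realize_relabel, realize_toFormula] at h4
      apply hn
      convert h4 using 1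
      have : p ∘ Sum.inr = (Fin.snoc (f ∘ x) a : Fin (n + 1) → N) := rfl
      rw [Function.comp_assoc, this]
      rw [Fin.comp_snoc]
      congr 1
      funext i
      simp [hwf]
    · exact realize_thySet.2 hN χ hχ
  exact ((f.toElementaryEmbedding htv).theory_model_iff Ts).2 hN

theorem companion_models_ec (T Ts : L.Theory) (h : IsModelCompanion T Ts)
    (M : Type (max u v)) [L.Structure M] [Nonempty M] (hM : M ⊨ Ts) :
    IsECFor (universalPart T) M := by
  obtain ⟨hmc, h1, h2⟩ := h
  obtain ⟨N', _, _, hN', ⟨g⟩⟩ := h2 M hM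
  refine ⟨universal_down g T (models_universalPart T hN'), ?_⟩
  intro N _ _ hN f k φ hφ x hx
  obtain ⟨N0, _, _, hN0, ⟨f0⟩⟩ := embeds_in_model T hN
  obtain ⟨N1, _, _, hN1, ⟨f1⟩⟩ := h1 N0 hN0
  have := existential_up f1 hφ (existential_up f0 hφ hx)
  exact (hmc M N1 hM hN1 ((f1.comp f0).comp f) k φ x).1 this

/-- One step of the construction of existentially closed extensions. -/
theorem ec_step (T : L.Theory) (M : Type (max u v)) [L.Structure M] [Nonempty M]
    (hM : M ⊨ universalPart T) :
    ∃ (M' : Type (max u v)) (_ : L.Structure M') (_ : Nonempty M') (i : M ↪[L] M'),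
      M' ⊨ universalPart T ∧ ∀ (N : Type (max u v)) [L.Structure N] [Nonempty N],
        N ⊨ universalPart T → ∀ (g : M' ↪[L] N) (k : ℕ) (φ : L.Formula (Fin k)),
          IsExistentialFormula φ → ∀ x : Fin k → M,
            φ.Realize (g ∘ i ∘ x) → φ.Realize (i ∘ x) := by
  let A : Set (L.Formula M) := {φ | ∀ (K N : Type (max u v)) [L.Structure K] [L.Structure N]
    (f : K ↪[L] N) (w : M → K), φ.Realize w → φ.Realize (f ∘ w)}
  let P : Set (Set (L.Formula M)) :=
    {G | G ⊆ A ∧ Realizable (thySet (universalPart T) M ∪ G)}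
  have hdiag : diag M ∈ P := by
    refine ⟨?_, M, inferInstance, inferInstance, id, ?_⟩
    · rintro φ ⟨hQ, -⟩ K N _ _ f w hw
      have := (hQ.realize_embedding f (v := w) (xs := default)).2 hw
      rwa [Subsingleton.elim (f ∘ (default : Fin 0 → K)) default] at this
    · rintro φ (hφ | hφ)
      · exact realize_thySet.2 hM φ hφ
      · exact hφ.2
  obtain ⟨G, hdG, hG⟩ := zorn_subset_nonempty P (by
    intro c hc hchain hne
    refine ⟨⋃₀ c, ⟨Set.sUnion_subset fun s hs => (hc hs).1, ?_⟩,
      fun s hs => Set.subset_sUnion_of_mem hs⟩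
    classical
    apply compactness
    intro s hs
    have hfin : ((s.filter (· ∈ ⋃₀ c) : Finset _) : Set (L.Formula M)) ⊆ ⋃₀ c := by
      intro φ hφ
      exact (Finset.mem_filter.1 hφ).2
    obtain ⟨G, hGc, hsG⟩ := DirectedOn.exists_mem_subset_of_finset_subset_biUnion (f := id) hne
      hchain.directedOn (s := s.filter (· ∈ ⋃₀ c))
      (hfin.trans Set.sUnion_eq_biUnion.subset)
    obtain ⟨K, i1, i2, w, hw⟩ := (hc hGc).2
    refine ⟨K, i1, i2, w, fun φ hφ => ?_⟩
    by_cases hd : φ ∈ ⋃₀ c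
    · exact hw φ (.inr (hsG (Finset.mem_coe.2 (Finset.mem_filter.2 ⟨hφ, hd⟩))))
    · exact hw φ (.inl ((hs hφ).resolve_right hd))) (diag M) hdiag
  obtain ⟨M', i1, i2, w, hw⟩ := hG.1.2
  obtain ⟨i, rfl⟩ := exists_embedding w fun θ hθ => hw θ (.inr (hdG hθ))
  refine ⟨M', i1, i2, i, realize_thySet.1 fun φ hφ => hw φ (.inl hφ), ?_⟩
  intro N _ _ hN g k φ hφ x hx
  have hmem : insert (φ.relabel x) G ∈ P := by
    refine ⟨Set.insert_subset ?_ hG.1.1, N, inferInstance, inferInstance, g ∘ i, ?_⟩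
    · intro K N _ _ f w hw
      rw [Formula.realize_relabel] at hw ⊢
      exact existential_up f hφ hw
    · rintro ψ (hψ | rfl | hψ)
      · exact realize_thySet.2 hN ψ hψ
      · rw [Formula.realize_relabel]; exact hx
      · exact hG.1.1 hψ _ _ g i (hw ψ (.inr hψ))
  have := hw _ (.inr (hG.2 hmem (Set.subset_insert _ _) (Set.mem_insert _ _)))
  rwa [Formula.realize_relabel] at this

theorem exists_ec_extension (T : L.Theory) (M : Type (max u v)) [L.Structure M] [Nonempty M]
    (hM : M ⊨ universalPart T) :
    ∃ (N : Type (max u v)) (_ : L.Structure N) (_ : Nonempty N),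
      IsECFor (universalPart T) N ∧ Nonempty (M ↪[L] N) := by
  have step : ∀ A : Theory.ModelType.{u, v, max u v} (universalPart T),
      ∃ (B : Theory.ModelType.{u, v, max u v} (universalPart T)) (i : A ↪[L] B),
      ∀ (N : Type (max u v)) [L.Structure N] [Nonempty N],
        N ⊨ universalPart T → ∀ (g : B ↪[L] N) (k : ℕ) (φ : L.Formula (Fin k)),
          IsExistentialFormula φ → ∀ x : Fin k → A,
            φ.Realize (g ∘ i ∘ x) → φ.Realize (i ∘ x) := by
    intro A
    obtain ⟨M', i1, i2, i, hM', h⟩ := ec_step T A A.is_model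
    exact ⟨Theory.ModelType.of _ M', i, h⟩
  choose F e he using step
  let G : ℕ → Theory.ModelType.{u, v, max u v} (universalPart T) := fun n =>
    Nat.rec (motive := fun _ => Theory.ModelType.{u, v, max u v} (universalPart T))
      (Theory.ModelType.of _ M) (fun _ A => F A) n
  let s : ∀ n : ℕ, (G n).Carrier ↪[L] (G (n + 1)).Carrier := fun n => e (G n)
  let D : Type (max u v) := Language.DirectLimit (fun n => (G n : Type (max u v))) (DirectedSystem.natLERec s)
  let : L.Structure D := Language.DirectLimit.instStructureDirectLimit _ _
  let o : ∀ n, (G n).Carrier ↪[L] D := fun n =>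
    Language.DirectLimit.of L ℕ (fun n => (G n : Type (max u v))) (DirectedSystem.natLERec s) n
  have hos : ∀ n x, o (n + 1) (s n x) = o n x := by
    intro n x
    have := Language.DirectLimit.of_f (L := L) (G := fun n => (G n : Type (max u v)))
      (f := DirectedSystem.natLERec s) (hij := Nat.le_succ n) (x := x)
    rw [← this]
    congr 1
    rw [DirectedSystem.coe_natLERec]
    exact (Nat.leRecOn_succ' (C := fun n => (G n).Carrier) (next := fun {k} => s k) x).symm
  have hlift : ∀ (k : ℕ) (x : Fin k → D), ∃ n, ∃ y : Fin k → G n, x = o n ∘ y := by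
    intro k x
    obtain ⟨n, y, hy⟩ := Language.DirectLimit.exists_quotient_mk'_sigma_mk'_eq _ _ x
    exact ⟨n, y, hy⟩
  have hne : Nonempty D := ⟨o 0 (Classical.arbitrary _)⟩
  refine ⟨D, inferInstance, hne, ⟨⟨fun φ hφ => ?_⟩, ?_⟩, ⟨o 0⟩⟩
  · have hφ' := hφ
    obtain ⟨⟨n, χ, hQ, rfl⟩, -⟩ := hφ
    refine realize_alls.2 fun z => ?_
    obtain ⟨m, y, rfl⟩ := hlift n z
    have h1 := realize_alls.1 ((G m).is_model.realize_of_mem _ hφ') y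
    have := (hQ.realize_embedding (o m)).2 h1
    rwa [Subsingleton.elim (o m ∘ (default : Empty → G m)) default] at this
  · intro N _ _ hN f k φ hφ x hx
    obtain ⟨m, y, rfl⟩ := hlift k x
    have hc : o m ∘ y = o (m + 1) ∘ (s m ∘ y) := by
      funext i; exact (hos m (y i)).symm
    rw [hc] at hx ⊢
    exact existential_up (o (m + 1)) hφ
      (he (G m) N hN (f.comp (o (m + 1))) k φ hφ y hx)

end MCAux

/-- Existence criterion: `T` has a model companion iff the class of existentially closed
models of `T_∀` is elementary. -/
theorem exists_modelCompanion_iff_ec_elementary (T : L.Theory) :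
    (∃ Tstar : L.Theory, IsModelCompanion T Tstar) ↔
      ∃ S : L.Theory, ∀ (M : Type (max u v)) [L.Structure M] [Nonempty M],
        M ⊨ S ↔ IsECFor (universalPart T) M := by
  constructor
  · rintro ⟨Ts, h⟩
    exact ⟨Ts, fun M _ _ => ⟨MCAux.companion_models_ec T Ts h M,
      MCAux.ec_models_companion T Ts h M⟩⟩
  · rintro ⟨S, hS⟩
    refine ⟨S, ?_, ?_, ?_⟩
    · intro M N _ _ _ _ hM hN f n φ x
      have := MCAux.elementary_of_ec S
        (fun M N _ _ _ _ hM hN f => ((hS M).1 hM).2 N ((hS N).1 hN).1 f) φ M N hM hN f x default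
      rwa [Subsingleton.elim (f ∘ (default : Fin 0 → M)) default] at this
    · intro M _ _ hM
      obtain ⟨N, i1, i2, hN, hf⟩ := MCAux.exists_ec_extension T M (MCAux.models_universalPart T hM)
      exact ⟨N, i1, i2, (hS N).2 hN, hf⟩
    · intro M _ _ hM
      exact MCAux.embeds_in_model T ((hS M).1 hM).1
end
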